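/- If T is a tree in the family 𝒯', i.e. T = T_{t₁,…,t_k} with k ≥ 2, t₁ ≥ 1 and t_k ≥ t₁ + ⋯ + t_{k−1}, then gpg'(T) = ℓ(T) − Δ(T) + 2, where ℓ(T) is the number of leaves of T and Δ(T) is the maximum degree of T. -/

import Mathlib

open Finset SimpleGraph

variable {V : Type*}

/-- `S` is in general position in `G`: no shortest path of `G` contains more than
two vertices of `S`. -/
def IsGPSet (G : SimpleGraph V) (S : Set V) : Prop :=
  ∀ ⦃u v : V⦄ (p : G.Walk u v), p.IsPath → p.length = G.dist u v →
    (S ∩ {x | x ∈ p.support}).ncard ≤ 2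

open scoped Classical in
/-- The set of vertices that can legally be played when the set of already selected
vertices is `S`. -/
noncomputable def playable [Fintype V] (G : SimpleGraph V) (S : Finset V) : Finset V :=
  Finset.univ.filter (fun v => v ∉ S ∧ IsGPSet G (↑(insert v S) : Set V))

open scoped Classical in
/-- Value (final set size with optimal play) of the Builder-Blocker general position game
from position `S` with the given player to move (`true` = Builder, the maximiser;
`false` = Blocker, the minimiser), computed with a fuel parameter. -/
noncomputable def gameValAux [Fintype V] (G : SimpleGraph V) : ℕ → Bool → Finset V → ℕ
  | 0, _, S => S.card
  | fuel + 1, turn, S =>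
    if h : (playable G S).Nonempty then
      if turn then (playable G S).sup' h (fun v => gameValAux G fuel (!turn) (insert v S))
      else (playable G S).inf' h (fun v => gameValAux G fuel (!turn) (insert v S))
    else S.card

/-- Value of the Builder-Blocker general position game from position `S`,
with `turn = true` meaning Builder (the maximiser) is to move. Since at most
`Fintype.card V - S.card` further moves are possible, this fuel suffices. -/
noncomputable def gameVal [Fintype V] (G : SimpleGraph V) (turn : Bool) (S : Finset V) : ℕ :=
  gameValAux G (Fintype.card V - S.card) turn S

/-- The B-game general position number: Builder moves first. -/
noncomputable def gpg [Fintype V] (G : SimpleGraph V) : ℕ := gameVal G true ∅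

/-- The B'-game general position number: Blocker moves first. -/
noncomputable def gpg' [Fintype V] (G : SimpleGraph V) : ℕ := gameVal G false ∅

open scoped Classical in
/-- The number of leaves of `G`. -/
noncomputable def leafCount [Fintype V] (G : SimpleGraph V) : ℕ :=
  (Finset.univ.filter fun v => G.degree v = 1).card

open scoped Classical in
/-- The maximum degree of `G`. -/
noncomputable def maxDeg [Fintype V] (G : SimpleGraph V) : ℕ :=
  Finset.univ.sup fun v => G.degree v

/-- Base relation for the tree `T_{t₁,…,t_k}`: the central path `u₁, …, u_k`
(encoded as `Sum.inl i`) with `t i` pendant leaves attached to `u_i`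
(encoded as `Sum.inr ⟨i, j⟩`). -/
def TmodelRel (k : ℕ) (t : Fin k → ℕ) :
    (Fin k ⊕ Σ i : Fin k, Fin (t i)) → (Fin k ⊕ Σ i : Fin k, Fin (t i)) → Prop
  | Sum.inl i, Sum.inl i' => (i' : ℕ) = (i : ℕ) + 1
  | Sum.inl i, Sum.inr ⟨i', _⟩ => i = i'
  | _, _ => False

/-- The tree `T_{t₁,…,t_k}`: a path `u₁, …, u_k` with `t i` leaves attached to `u_i`. -/
def Tmodel (k : ℕ) (t : Fin k → ℕ) : SimpleGraph (Fin k ⊕ Σ i : Fin k, Fin (t i)) :=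
  SimpleGraph.fromRel (TmodelRel k t)

section Game

variable [Fintype V] {G : SimpleGraph V}

lemma mem_playable {S : Finset V} {v : V} [DecidableEq V] :
    v ∈ playable G S ↔ v ∉ S ∧ IsGPSet G (↑(insert v S) : Set V) := by
  classical
  simp [playable]

lemma gameValAux_le {m : ℕ} (fuel : ℕ) (turn : Bool) (S : Finset V)
    (hS : IsGPSet G (S : Set V))
    (hm : ∀ S' : Finset V, S ⊆ S' → IsGPSet G (S' : Set V) → S'.card ≤ m) :
    gameValAux G fuel turn S ≤ m := by
  classical
  induction fuel generalizing turn S with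
  | zero => exact hm S subset_rfl hS
  | succ n ih =>
    have key : ∀ (turn : Bool), ∀ v ∈ playable G S, gameValAux G n turn (insert v S) ≤ m := by
      intro turn v hv
      exact ih turn _ (mem_playable.1 hv).2 fun S' h => hm S' ((subset_insert _ _).trans h)
    unfold gameValAux
    split_ifs with h ht
    · refine Finset.sup'_le _ _ fun v hv => ?_
      convert key (!turn) v hv
    · obtain ⟨v, hv⟩ := h
      refine (Finset.inf'_le _ hv).trans ?_
      convert key (!turn) v hv
    · exact hm S subset_rfl hS

lemma le_gameValAux {m : ℕ} (fuel : ℕ) (turn : Bool) (S : Finset V)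
    (hfuel : Fintype.card V ≤ fuel + S.card) (hS : IsGPSet G (S : Set V))
    (hm : ∀ S' : Finset V, S ⊆ S' → IsGPSet G (S' : Set V) → playable G S' = ∅ → m ≤ S'.card) :
    m ≤ gameValAux G fuel turn S := by
  classical
  induction fuel generalizing turn S with
  | zero =>
    have : S = univ := by
      rw [← Finset.card_eq_iff_eq_univ]
      exact le_antisymm (Finset.card_le_univ S) (by omega)
    refine hm S subset_rfl hS ?_
    ext v
    simp [mem_playable, this]
  | succ n ih =>
    have key : ∀ (turn : Bool), ∀ v ∈ playable G S, m ≤ gameValAux G n turn (insert v S) := by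
      intro turn v hv
      obtain ⟨hvS, hgp⟩ := mem_playable.1 hv
      refine ih turn _ ?_ hgp fun S' h => hm S' ((subset_insert _ _).trans h)
      rw [Finset.card_insert_of_notMem hvS]
      omega
    unfold gameValAux
    split_ifs with h ht
    · obtain ⟨v, hv⟩ := h
      refine le_trans ?_ (Finset.le_sup' _ hv)
      convert key (!turn) v hv
    · refine Finset.le_inf' _ _ fun v hv => ?_
      convert key (!turn) v hv
    · exact hm S subset_rfl hS (Finset.not_nonempty_iff_eq_empty.1 h)

lemma gpg'_le {m : ℕ} (v : V) (hv : IsGPSet G {v})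
    (hm : ∀ S : Finset V, v ∈ S → IsGPSet G (S : Set V) → S.card ≤ m) : gpg' G ≤ m := by
  classical
  obtain ⟨n, hn⟩ : ∃ n, Fintype.card V = n + 1 :=
    Nat.exists_eq_succ_of_ne_zero (Fintype.card_pos_iff.2 ⟨v⟩).ne'
  have hvp : v ∈ playable G ∅ := mem_playable.2 (by simpa using hv)
  simp only [gpg', gameVal, hn, Finset.card_empty, Nat.sub_zero]
  unfold gameValAux
  rw [dif_pos ⟨v, hvp⟩, if_neg (by simp)]
  refine (Finset.inf'_le _ hvp).trans ?_
  refine gameValAux_le _ _ _ (by simpa using hv) fun S hS => hm S (hS (by simp))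

lemma le_gpg' {m : ℕ} [Nonempty V] (hsing : ∀ v, IsGPSet G {v})
    (hm : ∀ v, ∃ w, w ≠ v ∧ IsGPSet G {w, v} ∧ ∀ S : Finset V, v ∈ S → w ∈ S →
      IsGPSet G (S : Set V) → playable G S = ∅ → m ≤ S.card) : m ≤ gpg' G := by
  classical
  obtain ⟨v₀⟩ := ‹Nonempty V›
  obtain ⟨n, hn⟩ : ∃ n, Fintype.card V = n + 2 := by
    obtain ⟨w, hw, -⟩ := hm v₀
    have : 1 < Fintype.card V := Fintype.one_lt_card_iff.2 ⟨w, v₀, hw⟩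
    exact ⟨Fintype.card V - 2, by omega⟩
  have hvp : v₀ ∈ playable G ∅ := mem_playable.2 (by simpa using hsing v₀)
  simp only [gpg', gameVal, hn, Finset.card_empty, Nat.sub_zero]
  unfold gameValAux
  rw [dif_pos ⟨v₀, hvp⟩, if_neg (by simp)]
  refine Finset.le_inf' _ _ fun v _ => ?_
  obtain ⟨w, hwv, hgp, hw⟩ := hm v
  have hwp : w ∈ playable G {v} := mem_playable.2 (by simpa using ⟨hwv, hgp⟩)
  have hins : ∀ h : DecidableEq V, @insert V (Finset V) (@Finset.instInsert V h) v ∅ = {v} := by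
    intro h; ext; simp
  rw [hins]
  unfold gameValAux
  rw [dif_pos ⟨w, hwp⟩, if_pos (by simp)]
  refine le_trans ?_ (Finset.le_sup' _ hwp)
  refine le_gameValAux _ _ _ ?_ (by simpa using hgp) fun S hS => hw S (hS (by simp)) (hS (by simp))
  rw [Finset.card_insert_of_notMem (by simpa using hwv)]
  simp [hn]

end Game

/-- A set is in general position iff no three of its vertices are metrically collinear. -/
lemma isGPSet_iff_dist {G : SimpleGraph V} (hG : G.Connected) [Finite V] (S : Set V) :
    IsGPSet G S ↔ ∀ a ∈ S, ∀ b ∈ S, ∀ c ∈ S, a ≠ b → b ≠ c → a ≠ c →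
      G.dist a b + G.dist b c ≠ G.dist a c := by
  classical
  constructor
  · intro h a ha b hb c hc hab hbc hac heq
    obtain ⟨p, hp⟩ := hG.exists_walk_length_eq_dist a b
    obtain ⟨q, hq⟩ := hG.exists_walk_length_eq_dist b c
    have hlen : (p.append q).length = G.dist a c := by
      rw [Walk.length_append, hp, hq, heq]
    have hle := h (p.append q) (Walk.isPath_of_length_eq_dist _ hlen) hlen
    have hsub : ({a, b, c} : Set V) ⊆ S ∩ {x | x ∈ (p.append q).support} := by
      rintro x (rfl | rfl | rfl)
      · exact ⟨ha, by simp⟩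
      · exact ⟨hb, by simp [Walk.mem_support_append_iff]⟩
      · exact ⟨hc, by simp⟩
    have h3 : ({a, b, c} : Set V).ncard = 3 := Set.ncard_eq_three.2 ⟨a, b, c, hab, hac, hbc, rfl⟩
    have := Set.ncard_le_ncard hsub (Set.toFinite _)
    omega
  · intro h u v p _ hlen
    by_contra! hcon
    obtain ⟨a, b, c, ha, hb, hc, hab, hac, hbc⟩ := (Set.two_lt_ncard_iff (Set.toFinite _)).1 hcon
    have hd : ∀ i j, i ≤ j → j ≤ p.length → G.dist (p.getVert i) (p.getVert j) = j - i := by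
      intro i j hij hj
      have h1 : G.dist u (p.getVert i) ≤ i := by
        have := dist_le (p.take i)
        rw [Walk.take_length] at this
        omega
      have h2 : G.dist (p.getVert j) v ≤ p.length - j := by
        have := dist_le (p.drop j)
        rwa [Walk.drop_length] at this
      have h3 : G.dist (p.getVert i) (p.getVert j) ≤ j - i := by
        have := dist_le ((p.drop i).take (j - i))
        rw [Walk.take_length, Walk.drop_getVert] at this
        rw [show i + (j - i) = j by omega] at this
        omega
      have h4 := hG.dist_triangle (u := u) (v := p.getVert i) (w := v)
      have h5 := hG.dist_triangle (u := p.getVert i) (v := p.getVert j) (w := v)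
      omega
    obtain ⟨i, rfl, hi⟩ := Walk.mem_support_iff_exists_getVert.1 ha.2
    obtain ⟨j, rfl, hj⟩ := Walk.mem_support_iff_exists_getVert.1 hb.2
    obtain ⟨l, rfl, hl⟩ := Walk.mem_support_iff_exists_getVert.1 hc.2
    have key : ∀ i j l, i ≤ j → j ≤ l → l ≤ p.length → p.getVert i ∈ S → p.getVert j ∈ S →
        p.getVert l ∈ S → p.getVert i ≠ p.getVert j → p.getVert j ≠ p.getVert l →
        p.getVert i ≠ p.getVert l → False := by
      intro i j l hij hjl hl hi hj hl' h1 h2 h3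
      apply h _ hi _ hj _ hl' h1 h2 h3
      rw [hd i j hij (by omega), hd j l hjl hl, hd i l (by omega) hl]
      omega
    rcases le_total i j with hij | hij <;> rcases le_total j l with hjl | hjl <;>
      rcases le_total i l with hil | hil
    · exact key i j l hij hjl hl ha.1 hb.1 hc.1 hab hbc hac
    · exact key i j l hij hjl hl ha.1 hb.1 hc.1 hab hbc hac
    · exact key i l j hil hjl hj ha.1 hc.1 hb.1 hac hbc.symm hab
    · exact key l i j hil hij hj hc.1 ha.1 hb.1 hac.symm hab hbc.symm
    · exact key j i l hij hil hl hb.1 ha.1 hc.1 hab.symm hac hbc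
    · exact key j l i hjl hil hi hb.1 hc.1 ha.1 hbc hac.symm hab.symm
    · exact key l j i hjl hij hi hc.1 hb.1 ha.1 hbc.symm hab.symm hac.symm
    · exact key l j i hjl hij hi hc.1 hb.1 ha.1 hbc.symm hab.symm hac.symm

namespace Tmodel

variable {k : ℕ} {t : Fin k → ℕ}

/-- Index of the central vertex nearest to a vertex. -/
def idx : (Fin k ⊕ Σ i : Fin k, Fin (t i)) → ℕ
  | Sum.inl i => i
  | Sum.inr x => x.1

/-- Distance from a vertex to the central path. -/
def height : (Fin k ⊕ Σ i : Fin k, Fin (t i)) → ℕ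
  | Sum.inl _ => 0
  | Sum.inr _ => 1

@[simp] lemma idx_inl (i : Fin k) : idx (t := t) (Sum.inl i) = i := rfl
@[simp] lemma idx_inr (x : Σ i : Fin k, Fin (t i)) : idx (Sum.inr x) = x.1 := rfl
@[simp] lemma height_inl (i : Fin k) : height (t := t) (Sum.inl i) = 0 := rfl
@[simp] lemma height_inr (x : Σ i : Fin k, Fin (t i)) : height (Sum.inr x) = 1 := rfl

lemma adj_inl_inl (i j : Fin k) : (Tmodel k t).Adj (Sum.inl i) (Sum.inl j) ↔
    (j : ℕ) = i + 1 ∨ (i : ℕ) = j + 1 := by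
  simp only [Tmodel, fromRel_adj, TmodelRel, ne_eq, Sum.inl.injEq, Fin.ext_iff]
  omega

@[simp] lemma adj_inl_inr (i : Fin k) (x : Σ i : Fin k, Fin (t i)) :
    (Tmodel k t).Adj (Sum.inl i) (Sum.inr x) ↔ i = x.1 := by
  simp [Tmodel, TmodelRel]

@[simp] lemma adj_inr_inl (i : Fin k) (x : Σ i : Fin k, Fin (t i)) :
    (Tmodel k t).Adj (Sum.inr x) (Sum.inl i) ↔ i = x.1 := by
  rw [adj_comm, adj_inl_inr]

@[simp] lemma not_adj_inr_inr (x y : Σ i : Fin k, Fin (t i)) :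
    ¬ (Tmodel k t).Adj (Sum.inr x) (Sum.inr y) := by
  simp [Tmodel, TmodelRel]

lemma exists_walk_inl (n : ℕ) (i j : Fin k) (h : (j : ℕ) = i + n) :
    ∃ p : (Tmodel k t).Walk (Sum.inl i) (Sum.inl j), p.length = n := by
  induction n generalizing j with
  | zero =>
    obtain rfl : j = i := Fin.ext (by simpa using h)
    exact ⟨Walk.nil, rfl⟩
  | succ n ih =>
    obtain ⟨p, hp⟩ := ih ⟨i + n, by omega⟩ rfl
    exact ⟨p.concat ((adj_inl_inl _ _).2 (Or.inl (by simpa using by omega))), by simp [hp]⟩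

lemma exists_walk_to_inl (v : Fin k ⊕ Σ i : Fin k, Fin (t i)) (i : Fin k) (hi : idx v = i) :
    ∃ p : (Tmodel k t).Walk v (Sum.inl i), p.length = height v := by
  rcases v with j | x
  · obtain rfl : j = i := Fin.ext hi
    exact ⟨Walk.nil, rfl⟩
  · exact ⟨Walk.cons ((adj_inr_inl _ _).2 (Fin.ext hi.symm)) Walk.nil, rfl⟩

lemma idx_lt (v : Fin k ⊕ Σ i : Fin k, Fin (t i)) : idx v < k := by
  rcases v with j | x
  · exact j.2
  · exact x.1.2

lemma exists_walk (v w : Fin k ⊕ Σ i : Fin k, Fin (t i)) (h : idx v ≤ idx w) :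
    ∃ p : (Tmodel k t).Walk v w, p.length = idx w - idx v + height v + height w := by
  obtain ⟨p, hp⟩ := exists_walk_to_inl v ⟨idx v, idx_lt v⟩ rfl
  obtain ⟨q, hq⟩ := exists_walk_to_inl w ⟨idx w, idx_lt w⟩ rfl
  obtain ⟨r, hr⟩ := exists_walk_inl (t := t) (idx w - idx v) ⟨idx v, idx_lt v⟩ ⟨idx w, idx_lt w⟩
    (by simpa using by omega)
  refine ⟨(p.append r).append q.reverse, ?_⟩
  simp only [Walk.length_append, Walk.length_reverse, hp, hq, hr]
  omega

lemma length_ge {v w : Fin k ⊕ Σ i : Fin k, Fin (t i)} (p : (Tmodel k t).Walk v w) :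
    v = w ∨ idx w - idx v + height v + height w ≤ p.length ∧
      idx v - idx w + height v + height w ≤ p.length := by
  induction p with
  | nil => exact Or.inl rfl
  | @cons u v w h p ih =>
    by_cases huw : u = w
    · exact Or.inl huw
    right
    rw [Walk.length_cons]
    rcases ih with rfl | ih <;> rcases u with i | x <;> rcases v with j | y <;>
      simp_all [adj_inl_inl] <;> omega

lemma dist_eq {v w : Fin k ⊕ Σ i : Fin k, Fin (t i)} (hne : v ≠ w) (h : idx v ≤ idx w) :
    (Tmodel k t).dist v w = idx w - idx v + height v + height w := by
  obtain ⟨p, hp⟩ := exists_walk v w h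
  obtain ⟨q, hq⟩ := p.reachable.exists_walk_length_eq_dist
  have h1 := dist_le p
  have h2 := (length_ge q).resolve_left hne
  omega

lemma connected (hk : 0 < k) : (Tmodel k t).Connected := by
  have : Nonempty (Fin k ⊕ Σ i : Fin k, Fin (t i)) := ⟨Sum.inl ⟨0, hk⟩⟩
  refine ⟨fun v w => ?_⟩
  rcases le_total (idx v) (idx w) with h | h
  · exact (exists_walk v w h).choose.reachable
  · exact (exists_walk w v h).choose.reachable.symm

/-- In `Tmodel`, general position only fails when a selected central vertex separates two
other selected vertices. -/
lemma isGPSet_iff (hk : 0 < k) (S : Set (Fin k ⊕ Σ i : Fin k, Fin (t i))) :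
    IsGPSet (Tmodel k t) S ↔ ∀ j, Sum.inl j ∈ S → ∀ a ∈ S, ∀ c ∈ S, a ≠ Sum.inl j →
      c ≠ Sum.inl j → a ≠ c → ¬ (idx a ≤ j ∧ (j : ℕ) ≤ idx c) := by
  rw [isGPSet_iff_dist (connected hk)]
  constructor
  · rintro h j hj a ha c hc haj hcj hac ⟨h1, h2⟩
    apply h a ha _ hj c hc haj hcj.symm hac
    rw [dist_eq haj h1, dist_eq hcj.symm h2, dist_eq hac (h1.trans h2)]
    simp
    omega
  · intro h
    have key : ∀ a ∈ S, ∀ b ∈ S, ∀ c ∈ S, a ≠ b → b ≠ c → a ≠ c → idx a ≤ idx c →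
        (Tmodel k t).dist a b + (Tmodel k t).dist b c ≠ (Tmodel k t).dist a c := by
      intro a ha b hb c hc hab hbc hac hle heq
      rw [dist_eq hac hle] at heq
      have hb' : height b = 0 ∧ idx a ≤ idx b ∧ idx b ≤ idx c := by
        rcases le_total (idx a) (idx b) with h1 | h1 <;>
          rcases le_total (idx b) (idx c) with h2 | h2
        · rw [dist_eq hab h1, dist_eq hbc h2] at heq; omega
        · rw [dist_eq hab h1, dist_comm, dist_eq hbc.symm h2] at heq; omega
        · rw [dist_comm, dist_eq hab.symm h1, dist_eq hbc h2] at heq; omega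
        · rw [dist_comm, dist_eq hab.symm h1, dist_comm, dist_eq hbc.symm h2] at heq; omega
      rcases b with j | x
      · exact h j hb a ha c hc hab hbc.symm hac hb'.2
      · simp at hb'
    intro a ha b hb c hc hab hbc hac heq
    rcases le_total (idx a) (idx c) with h1 | h1
    · exact key a ha b hb c hc hab hbc hac h1 heq
    · refine key c hc b hb a ha hbc.symm hab.symm hac.symm h1 ?_
      rw [dist_comm (u := c), dist_comm (u := b) (v := a), dist_comm (u := c) (v := a)]
      omega

lemma isGPSet_pair (hk : 0 < k) (v w : Fin k ⊕ Σ i : Fin k, Fin (t i)) :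
    IsGPSet (Tmodel k t) {v, w} := by
  rw [isGPSet_iff hk]
  rintro j (rfl | rfl) a (rfl | rfl) c (rfl | rfl) <;> simp_all

lemma isGPSet_singleton (hk : 0 < k) (v : Fin k ⊕ Σ i : Fin k, Fin (t i)) :
    IsGPSet (Tmodel k t) {v} := by
  simpa using isGPSet_pair hk v v

/-- The leaves not attached to the last central vertex. -/
def innerLeaves (k : ℕ) (t : Fin k → ℕ) : Finset (Fin k ⊕ Σ i : Fin k, Fin (t i)) :=
  ((univ.filter fun j : Fin k => (j : ℕ) < k - 1).sigma fun _ => univ).map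
    Function.Embedding.inr

lemma card_innerLeaves : (innerLeaves k t).card =
    ∑ j ∈ univ.filter (fun j : Fin k => (j : ℕ) < k - 1), t j := by
  simp [innerLeaves]

lemma mem_innerLeaves {v : Fin k ⊕ Σ i : Fin k, Fin (t i)} :
    v ∈ innerLeaves k t ↔ height v = 1 ∧ idx v < k - 1 := by
  rcases v with j | x
  · simp [innerLeaves]
  · simp [innerLeaves]

/-- The leaves attached to the central vertex `i`. -/
def leavesAt (t : Fin k → ℕ) (i : Fin k) : Finset (Fin k ⊕ Σ i : Fin k, Fin (t i)) :=
  (univ : Finset (Fin (t i))).map ((Function.Embedding.sigmaMk i).trans Function.Embedding.inr)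

lemma card_leavesAt (i : Fin k) : (leavesAt t i).card = t i := by
  simp [leavesAt]

lemma mem_leavesAt {i : Fin k} {v : Fin k ⊕ Σ i : Fin k, Fin (t i)} :
    v ∈ leavesAt t i ↔ height v = 1 ∧ idx v = i := by
  rcases v with j | ⟨j, y⟩
  · simp [leavesAt]
  · simp only [leavesAt, mem_map, mem_univ, true_and, Function.Embedding.trans_apply,
      Function.Embedding.inr_apply, Function.Embedding.sigmaMk_apply, height_inr, idx_inr,
      Sum.inr.injEq]
    constructor
    · rintro ⟨a, ha⟩
      exact congrArg (fun z : Σ i : Fin k, Fin (t i) => (z.1 : ℕ)) ha.symm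
    · intro h
      obtain rfl : j = i := Fin.ext h
      exact ⟨y, rfl⟩

lemma eq_inl_of_height {v : Fin k ⊕ Σ i : Fin k, Fin (t i)} {i : Fin k} (h : height v = 0)
    (hi : idx v = i) : v = Sum.inl i := by
  rcases v with j | x
  · exact congrArg _ (Fin.ext hi)
  · simp at h

lemma height_cases (v : Fin k ⊕ Σ i : Fin k, Fin (t i)) : height v = 0 ∨ height v = 1 := by
  rcases v with j | x <;> simp

lemma card_le_of_last_mem (hk : 1 < k) (h1 : 1 ≤ t ⟨0, by omega⟩)
    {S : Finset (Fin k ⊕ Σ i : Fin k, Fin (t i))} (hS : IsGPSet (Tmodel k t) (S : Set _))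
    (hl : Sum.inl ⟨k - 1, by omega⟩ ∈ S) : S.card ≤ (innerLeaves k t).card + 1 := by
  rw [isGPSet_iff (by omega)] at hS
  simp only [mem_coe] at hS
  have hzero : (Sum.inr ⟨⟨0, by omega⟩, ⟨0, h1⟩⟩ : Fin k ⊕ Σ i : Fin k, Fin (t i)) ∈
      innerLeaves k t := by
    rw [mem_innerLeaves]; simp; omega
  by_cases hb : ∃ b ∈ S, b ∈ leavesAt t ⟨k - 1, by omega⟩
  · obtain ⟨b, hbS, hb⟩ := hb
    rw [mem_leavesAt] at hb
    have hsub : S ⊆ {Sum.inl ⟨k - 1, by omega⟩, b} := by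
      intro x hx
      by_contra hcon
      simp only [mem_insert, mem_singleton, not_or] at hcon
      refine hS _ hl x hx b hbS hcon.1 ?_ hcon.2 ⟨?_, hb.2.ge⟩
      · rintro rfl; simp at hb
      · have := idx_lt x
        simp; omega
    have := card_le_card hsub
    have := card_le_two (a := (Sum.inl ⟨k - 1, by omega⟩ : Fin k ⊕ Σ i : Fin k, Fin (t i))) (b := b)
    have := card_pos.2 ⟨_, hzero⟩
    omega
  · have hleaf : ∀ x ∈ S, height x = 1 → x ∈ innerLeaves k t := by
      intro x hx hx1
      rw [mem_innerLeaves]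
      refine ⟨hx1, ?_⟩
      by_contra hcon
      refine hb ⟨x, hx, mem_leavesAt.2 ⟨hx1, ?_⟩⟩
      have := idx_lt x
      simp; omega
    by_cases hj : ∃ j : Fin k, (j : ℕ) < k - 1 ∧ Sum.inl j ∈ S
    · obtain ⟨j, hjk, hj⟩ := hj
      have hlj : (Sum.inl ⟨k - 1, by omega⟩ : Fin k ⊕ Σ i : Fin k, Fin (t i)) ≠ Sum.inl j := by
        simp [Fin.ext_iff]; omega
      have hgt : ∀ x ∈ S, x ≠ Sum.inl j → (j : ℕ) < idx x := by
        intro x hx hxj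
        by_cases hxl : x = Sum.inl ⟨k - 1, by omega⟩
        · simpa [hxl] using hjk
        · by_contra hcon
          exact hS j hj x hx _ hl hxj hlj hxl ⟨by omega, by simp; omega⟩
      have hsub : S ⊆ insert (Sum.inl ⟨k - 1, by omega⟩) (insert (Sum.inl j)
          ((innerLeaves k t).erase (Sum.inr ⟨⟨0, by omega⟩, ⟨0, h1⟩⟩))) := by
        intro x hx
        simp only [mem_insert, mem_erase]
        by_contra! hcon
        obtain ⟨hc1, hc2, hc3⟩ := hcon
        have hxgt := hgt x hx hc2
        rcases height_cases x with h0 | h0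
        · have hx' : x = Sum.inl ⟨idx x, idx_lt x⟩ := eq_inl_of_height h0 rfl
          rw [hx'] at hx
          exact hS _ hx _ hj _ hl (by rw [← hx']; exact hc2.symm) (by rw [← hx']; exact hc1.symm)
            hlj.symm ⟨hxgt.le, by have := idx_lt x; simp; omega⟩
        · refine hc3 ?_ (hleaf x hx h0)
          rintro rfl
          simp at hxgt
      refine (card_le_card hsub).trans ((card_insert_le _ _).trans ?_)
      have := card_insert_le (Sum.inl j)
        ((innerLeaves k t).erase (Sum.inr ⟨⟨0, by omega⟩, ⟨0, h1⟩⟩))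
      have := card_erase_add_one hzero
      omega
    · have hsub : S ⊆ insert (Sum.inl ⟨k - 1, by omega⟩) (innerLeaves k t) := by
        intro x hx
        rw [mem_insert]
        rcases height_cases x with h0 | h0
        · left
          refine eq_inl_of_height h0 ?_
          by_contra hcon
          refine hj ⟨⟨idx x, idx_lt x⟩, ?_, ?_⟩
          · have := idx_lt x
            simp at hcon ⊢; omega
          · rwa [← eq_inl_of_height (i := ⟨idx x, idx_lt x⟩) h0 rfl]
        · exact Or.inr (hleaf x hx h0)
      exact (card_le_card hsub).trans (card_insert_le _ _)

lemma le_card_of_leaf_last_mem (hk : 0 < k) {S : Finset (Fin k ⊕ Σ i : Fin k, Fin (t i))}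
    (hS : IsGPSet (Tmodel k t) (S : Set _)) (hmax : playable (Tmodel k t) S = ∅)
    {b x : Fin k ⊕ Σ i : Fin k, Fin (t i)} (hb : b ∈ leavesAt t ⟨k - 1, by omega⟩) (hbS : b ∈ S)
    (hx : idx x < k - 1) (hxS : x ∈ S) : t ⟨k - 1, by omega⟩ + 1 ≤ S.card := by
  have hGP := hS
  rw [isGPSet_iff hk] at hGP
  simp only [mem_coe] at hGP
  rw [mem_leavesAt] at hb
  simp only at hb
  have hxb : x ≠ b := by rintro rfl; omega
  have hbinl : ∀ j, b ≠ Sum.inl j := by rintro j rfl; simp at hb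
  have hlast : ∀ j : Fin k, Sum.inl j ∈ S → ¬ k - 1 ≤ (j : ℕ) := by
    intro j hj hle
    exact hGP j hj x hxS b hbS (by rintro rfl; simp at hx; omega) (hbinl j) hxb (by omega)
  have hsub : insert x (leavesAt t ⟨k - 1, by omega⟩) ⊆ S := by
    refine insert_subset hxS fun b' hb' => ?_
    rw [mem_leavesAt] at hb'
    simp only at hb'
    by_contra hcon
    have hb'inl : ∀ j, b' ≠ Sum.inl j := by rintro j rfl; simp at hb'
    refine (notMem_empty b') (hmax ▸ mem_playable.2 ⟨hcon, ?_⟩)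
    rw [isGPSet_iff hk]
    simp only [coe_insert, Set.mem_insert_iff, mem_coe]
    rintro j hj a ha c hc haj hcj hac ⟨h1, h2⟩
    replace hj := hj.resolve_left (hb'inl j).symm
    have hjl := hlast j hj
    replace ha := ha.resolve_left (by rintro rfl; omega)
    rcases hc with rfl | hc
    · exact hGP j hj a ha b hbS haj (hbinl j) (by rintro rfl; omega) (by omega)
    · exact hGP j hj a ha c hc haj hcj hac ⟨h1, h2⟩
  have := card_le_card hsub
  rwa [card_insert_of_notMem, card_leavesAt] at this
  rw [mem_leavesAt]
  simp; omega

lemma le_card_of_last_mem (hk : 1 < k) {S : Finset (Fin k ⊕ Σ i : Fin k, Fin (t i))}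
    (hS : IsGPSet (Tmodel k t) (S : Set _)) (hmax : playable (Tmodel k t) S = ∅)
    {a : Fin k ⊕ Σ i : Fin k, Fin (t i)} (ha : a ∈ leavesAt t ⟨0, by omega⟩) (haS : a ∈ S)
    (hl : Sum.inl ⟨k - 1, by omega⟩ ∈ S) : (innerLeaves k t).card + 1 ≤ S.card := by
  have hGP := hS
  rw [isGPSet_iff (by omega)] at hGP
  simp only [mem_coe] at hGP
  rw [mem_leavesAt] at ha
  simp only at ha
  have hainl : ∀ j, a ≠ Sum.inl j := by rintro j rfl; simp at ha
  have hsub : insert (Sum.inl ⟨k - 1, by omega⟩) (innerLeaves k t) ⊆ S := by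
    refine insert_subset hl fun y hy => ?_
    rw [mem_innerLeaves] at hy
    by_contra hcon
    have hyinl : ∀ j, y ≠ Sum.inl j := by rintro j rfl; simp at hy
    refine (notMem_empty y) (hmax ▸ mem_playable.2 ⟨hcon, ?_⟩)
    rw [isGPSet_iff (by omega)]
    simp only [coe_insert, Set.mem_insert_iff, mem_coe]
    rintro j hj a' - c hc - hcj - ⟨-, h2⟩
    replace hj := hj.resolve_left (hyinl j).symm
    have hjl : (j : ℕ) = k - 1 := by
      by_contra hne
      exact hGP j hj a haS _ hl (hainl j) (by simpa [Fin.ext_iff] using Ne.symm hne) (hainl _)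
        ⟨by omega, by simp; omega⟩
    replace hc := hc.resolve_left (by rintro rfl; omega)
    exact hGP j hj a haS c hc (hainl j) hcj (by rintro rfl; omega) ⟨by omega, h2⟩
  have := card_le_card hsub
  rwa [card_insert_of_notMem (by simp [mem_innerLeaves])] at this

lemma sum_eq (hk : 0 < k) : ∑ i, t i =
    ∑ j ∈ univ.filter (fun j : Fin k => (j : ℕ) < k - 1), t j + t ⟨k - 1, by omega⟩ := by
  rw [← sum_filter_add_sum_filter_not univ (fun j : Fin k => (j : ℕ) < k - 1)]
  congr 1
  rw [show univ.filter (fun j : Fin k => ¬ (j : ℕ) < k - 1) = {⟨k - 1, by omega⟩} by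
    ext j; simp [Fin.ext_iff]; omega]
  simp

open scoped Classical in
lemma degree_inr (x : Σ i : Fin k, Fin (t i)) : (Tmodel k t).degree (Sum.inr x) = 1 := by
  rw [← card_neighborFinset_eq_degree, card_eq_one]
  refine ⟨Sum.inl x.1, ?_⟩
  ext (j | y) <;> simp

open scoped Classical in
lemma degree_inl_le (i : Fin k) : (Tmodel k t).degree (Sum.inl i) ≤
    t i + ((if (i : ℕ) = 0 then 0 else 1) + if (i : ℕ) = k - 1 then 0 else 1) := by
  rw [← card_neighborFinset_eq_degree]
  have hsub : (Tmodel k t).neighborFinset (Sum.inl i) ⊆ leavesAt t i ∪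
      ((if h : (i : ℕ) = 0 then ∅ else {Sum.inl ⟨i - 1, by omega⟩}) ∪
        if h : (i : ℕ) = k - 1 then ∅ else {Sum.inl ⟨i + 1, by omega⟩}) := by
    rintro (j | x) h
    · rw [mem_neighborFinset, adj_inl_inl] at h
      simp only [mem_union]
      right
      rcases h with h | h
      · right
        rw [dif_neg (by omega)]
        simp [Fin.ext_iff, h]
      · left
        rw [dif_neg (by omega)]
        simp [h]
    · rw [mem_neighborFinset, adj_inl_inr] at h
      simp [mem_leavesAt, h]
  refine (card_le_card hsub).trans ((card_union_le _ _).trans ?_)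
  rw [card_leavesAt]
  refine Nat.add_le_add_left ((card_union_le _ _).trans ?_) _
  split_ifs <;> simp

open scoped Classical in
lemma le_degree_inl (i j : Fin k) (hij : (j : ℕ) = i + 1 ∨ (i : ℕ) = j + 1) :
    t i + 1 ≤ (Tmodel k t).degree (Sum.inl i) := by
  rw [← card_neighborFinset_eq_degree, ← card_leavesAt (t := t) i,
    ← card_insert_of_notMem (a := Sum.inl j) (by simp [mem_leavesAt])]
  refine card_le_card (insert_subset (by simpa [adj_inl_inl] using hij) ?_)
  rintro (l | x) h
  · simp [mem_leavesAt] at h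
  · rw [mem_leavesAt] at h
    simpa using Fin.ext h.2.symm

open scoped Classical in
lemma two_le_degree_inl (hk : 1 < k) (h1 : 1 ≤ t ⟨0, by omega⟩) (hl : 1 ≤ t ⟨k - 1, by omega⟩)
    (i : Fin k) : 2 ≤ (Tmodel k t).degree (Sum.inl i) := by
  by_cases h0 : (i : ℕ) = 0
  · rw [show i = ⟨0, by omega⟩ from Fin.ext h0]
    have := le_degree_inl (t := t) ⟨0, by omega⟩ ⟨1, by omega⟩ (by simp)
    omega
  by_cases hlast : (i : ℕ) = k - 1
  · rw [show i = ⟨k - 1, by omega⟩ from Fin.ext hlast]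
    have := le_degree_inl (t := t) ⟨k - 1, by omega⟩ ⟨k - 2, by omega⟩ (by simp; omega)
    omega
  rw [← card_neighborFinset_eq_degree]
  refine one_lt_card.2 ⟨Sum.inl ⟨i - 1, by omega⟩, ?_, Sum.inl ⟨i + 1, by omega⟩, ?_, ?_⟩
  · simp [adj_inl_inl]; omega
  · simp [adj_inl_inl]
  · simp

lemma leafCount_eq (hk : 1 < k) (h1 : 1 ≤ t ⟨0, by omega⟩) (hl : 1 ≤ t ⟨k - 1, by omega⟩) :
    leafCount (Tmodel k t) = ∑ i, t i := by
  classical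
  have : (univ.filter fun v => (Tmodel k t).degree v = 1) =
      (univ : Finset (Σ i : Fin k, Fin (t i))).map Function.Embedding.inr := by
    ext (i | x)
    · have := two_le_degree_inl hk h1 hl i
      simp; omega
    · simp [degree_inr]
  rw [leafCount]
  convert congrArg card this
  simp

lemma maxDeg_eq (hk : 1 < k) (h1 : 1 ≤ t ⟨0, by omega⟩)
    (hlast : ∑ j ∈ univ.filter (fun j : Fin k => (j : ℕ) < k - 1), t j ≤ t ⟨k - 1, by omega⟩) :
    maxDeg (Tmodel k t) = t ⟨k - 1, by omega⟩ + 1 := by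
  classical
  refine le_antisymm (Finset.sup_le fun v _ => ?_) ?_
  · rcases v with i | x
    · refine (degree_inl_le i).trans ?_
      by_cases hik : (i : ℕ) = k - 1
      · rw [if_pos hik, show i = ⟨k - 1, by omega⟩ from Fin.ext hik]
        split_ifs <;> simp
      have hmem : ∀ j : Fin k, (j : ℕ) < k - 1 →
          j ∈ univ.filter (fun j : Fin k => (j : ℕ) < k - 1) := by simp
      by_cases h0 : (i : ℕ) = 0
      · have := single_le_sum (f := t) (fun _ _ => Nat.zero_le _) (hmem i (by omega))
        rw [if_pos h0, if_neg hik]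
        omega
      · have hne : i ≠ ⟨0, by omega⟩ := fun h => h0 (by rw [h])
        have := sum_le_sum_of_subset (f := t) (insert_subset (hmem i (by omega))
          (singleton_subset_iff.2 (hmem ⟨0, by omega⟩ (by simp; omega))))
        rw [sum_pair hne] at this
        rw [if_neg h0, if_neg hik]
        omega
    · rw [degree_inr]; omega
  · exact (le_degree_inl _ ⟨k - 2, by omega⟩ (by simp; omega)).trans
      (Finset.le_sup (f := fun v => (Tmodel k t).degree v) (mem_univ _))

lemma exists_mem_leavesAt {i : Fin k} (h : 1 ≤ t i) : ∃ v, v ∈ leavesAt t i :=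
  card_pos.1 (by rwa [card_leavesAt])

end Tmodel

open Tmodel in
/-- If `T = T_{t₁,…,t_k} ∈ 𝒯'`, i.e. `k ≥ 2`, `t₁ ≥ 1` and `t_k ≥ t₁ + ⋯ + t_{k-1}`,
then `gpg'(T) = ℓ(T) - Δ(T) + 2`. -/
theorem stmt_18 (k : ℕ) (hk : 2 ≤ k) (t : Fin k → ℕ) (h1 : 1 ≤ t ⟨0, by omega⟩)
    (hlast : ∑ j ∈ Finset.univ.filter (fun j : Fin k => (j : ℕ) < k - 1), t j ≤
      t ⟨k - 1, by omega⟩) :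
    gpg' (Tmodel k t) = leafCount (Tmodel k t) - maxDeg (Tmodel k t) + 2 := by
  have hs : 1 ≤ ∑ j ∈ Finset.univ.filter (fun j : Fin k => (j : ℕ) < k - 1), t j :=
    h1.trans (single_le_sum (f := t) (fun _ _ => Nat.zero_le _) (by simp; omega))
  have hval : leafCount (Tmodel k t) - maxDeg (Tmodel k t) + 2 = (innerLeaves k t).card + 1 := by
    rw [leafCount_eq hk h1 (hs.trans hlast), maxDeg_eq hk h1 hlast, sum_eq (by omega),
      card_innerLeaves]
    omega
  rw [hval]
  have hk0 : 0 < k := by omega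
  obtain ⟨a, ha⟩ := exists_mem_leavesAt h1
  obtain ⟨b, hb⟩ := exists_mem_leavesAt (hs.trans hlast)
  have ha' := mem_leavesAt.1 ha
  have hb' := mem_leavesAt.1 hb
  simp only at ha' hb'
  refine le_antisymm (gpg'_le (Sum.inl ⟨k - 1, by omega⟩) (isGPSet_singleton hk0 _)
    fun S hl hS => card_le_of_last_mem hk h1 hS hl) ?_
  have : Nonempty (Fin k ⊕ Σ i : Fin k, Fin (t i)) := ⟨a⟩
  refine le_gpg' (isGPSet_singleton hk0) fun v => ?_
  by_cases hv : idx v < k - 1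
  · refine ⟨b, by rintro rfl; omega, isGPSet_pair hk0 _ _, fun S hvS hbS hS hmax => ?_⟩
    have := le_card_of_leaf_last_mem hk0 hS hmax hb hbS hv hvS
    rw [card_innerLeaves]
    omega
  have hvk : idx v = k - 1 := by have := idx_lt v; omega
  refine ⟨a, by rintro rfl; omega, isGPSet_pair hk0 _ _, fun S hvS haS hS hmax => ?_⟩
  rcases height_cases v with h0 | h0
  · rw [eq_inl_of_height (i := ⟨k - 1, by omega⟩) h0 hvk] at hvS
    exact le_card_of_last_mem hk hS hmax ha haS hvS
  · have := le_card_of_leaf_last_mem hk0 hS hmax (mem_leavesAt.2 ⟨h0, hvk⟩) hvS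
      (x := a) (by omega) haS
    rw [card_innerLeaves]
    omega
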